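/- arXiv:0806.0837 — 4 statements merged into one kernel-verified Lean document; each statement's English description precedes it below -/
import Mathlib

section
/- Let Σ be a finite type, let l, w, N be natural numbers, let S : Fin l → ℕ → Σ be a draw sequence, and let F : (Fin l → Σ) → (Fin l → Fin 2^w) be any (deterministic) decoding function. Then the number of messages m : Fin l → Fin 2^w for which there exists t : Fin l → Σ with F(t) = m and an index function j : Fin l → ℕ satisfying S(i, j(i)) = t(i) for all i and ∑_i (j(i) + 1) ≤ N is at most C(N, l). Consequently, the probability that a uniformly random message m has such a low-weight encoding is at most C(N, l) / 2^{l·w}. -/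
/-- The tuples `j : Fin l → ℕ` with `∑ i, (j i + 1) ≤ N` lie in a finset of cardinality at most
`N.choose l`: adjoining the slack as a new coordinate gives an element of an antidiagonal. -/
theorem exists_finset_sum_add_one_le_card_le_choose (l N : ℕ) :
    ∃ J : Finset (Fin l → ℕ), (∀ j : Fin l → ℕ, ∑ i, (j i + 1) ≤ N → j ∈ J) ∧
      J.card ≤ N.choose l := by
  classical
  rcases lt_or_ge N l with h | h
  · refine ⟨∅, fun j hj ↦ ?_, by simp⟩
    simp only [Finset.sum_add_distrib, Finset.sum_const, Finset.card_univ, Fintype.card_fin,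
      smul_eq_mul, mul_one] at hj
    lia
  · refine ⟨((Finset.univ : Finset (Fin (l + 1))).finsuppAntidiag (N - l)).image
      (fun f i ↦ f i.succ), fun j hj ↦ ?_, Finset.card_image_le.trans ?_⟩
    · simp only [Finset.sum_add_distrib, Finset.sum_const, Finset.card_univ, Fintype.card_fin,
        smul_eq_mul, mul_one] at hj
      refine Finset.mem_image.2 ⟨Finsupp.equivFunOnFinite.symm
        (Fin.cons (N - l - ∑ i, j i) j : Fin (l + 1) → ℕ), ?_, ?_⟩
      · simp only [Finset.mem_finsuppAntidiag, Finsupp.coe_equivFunOnFinite_symm,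
          Fin.sum_univ_succ, Fin.cons_zero, Fin.cons_succ, Finset.subset_univ, and_true]
        lia
      · simp
    · rw [Finset.card_finsuppAntidiag_nat_eq_choose, Finset.card_univ, Fintype.card_fin,
        show l + 1 + (N - l) - 1 = N by lia, Nat.choose_symm h]

/-- The tree lemma (Lemma 1): for any draw sequence `S` and any deterministic
decoder `F`, the number of messages `m : Fin l → Fin 2^w` that admit an encoding
`t` of weight at most `N` (i.e. `F t = m` and there are indices `j i` with
`S i (j i) = t i` and `∑ i (j i + 1) ≤ N`) is at most `C(N, l)`; consequently
a uniformly random message has such a low-weight encoding with probability at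
most `C(N, l) / 2^(l·w)`. -/
theorem card_low_weight_messages_le_choose {A : Type*} [Fintype A] [DecidableEq A]
    (l w N : ℕ) (S : Fin l → ℕ → A) (F : (Fin l → A) → (Fin l → Fin (2 ^ w))) :
    Nat.card {m : Fin l → Fin (2 ^ w) // ∃ t : Fin l → A, F t = m ∧
        ∃ j : Fin l → ℕ, (∀ i, S i (j i) = t i) ∧ ∑ i, (j i + 1) ≤ N} ≤ N.choose l ∧
    (Nat.card {m : Fin l → Fin (2 ^ w) // ∃ t : Fin l → A, F t = m ∧
        ∃ j : Fin l → ℕ, (∀ i, S i (j i) = t i) ∧ ∑ i, (j i + 1) ≤ N} : ℝ) / 2 ^ (l * w)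
      ≤ (N.choose l : ℝ) / 2 ^ (l * w) := by
  classical
  obtain ⟨J, hJ, hcard⟩ := exists_finset_sum_add_one_le_card_le_choose l N
  have key : Nat.card {m : Fin l → Fin (2 ^ w) // ∃ t : Fin l → A, F t = m ∧
      ∃ j : Fin l → ℕ, (∀ i, S i (j i) = t i) ∧ ∑ i, (j i + 1) ≤ N} ≤ N.choose l := by
    rw [Nat.card_eq_fintype_card, Fintype.card_subtype]
    refine (Finset.card_le_card (t := J.image fun j ↦ F fun i ↦ S i (j i)) ?_).trans
      (Finset.card_image_le.trans hcard)
    intro m hm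
    obtain ⟨t, rfl, j, hj, hN⟩ := (Finset.mem_filter.1 hm).2
    exact Finset.mem_image.2 ⟨j, hJ j hN, congrArg F (funext hj)⟩
  exact ⟨key, by gcongr⟩
end

section
/- Let h and w be natural numbers and set x = 2^{−h} · (2^w − 1). If x ≤ 1/2, then w + (2^w − 1) · 2^{−h} · log₂(2^{−h}) + (1 − x) · log₂(1 − x) ≥ w − (h + 2) · 2^{w−h}. -/
/-- A bound on `y * log₂ y` for positive `y`, from `1 - y⁻¹ ≤ log y` and `1 / 2 ≤ log 2`. -/
theorem neg_two_mul_one_sub_le_mul_logb_two {y : ℝ} (hy : 0 < y) (hy1 : y ≤ 1) :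
    -(2 * (1 - y)) ≤ y * Real.logb 2 y := by
  have hlog2 : (1 / 2 : ℝ) < Real.log 2 := by linarith [Real.log_two_gt_d9]
  have hmul : y - 1 ≤ y * Real.log y := by
    have := mul_le_mul_of_nonneg_left (Real.one_sub_inv_le_log_of_pos hy) hy.le
    rwa [mul_sub, mul_inv_cancel₀ hy.ne', mul_one] at this
  rw [Real.logb, ← mul_div_assoc, le_div_iff₀ (by linarith)]
  nlinarith

/-- Capacity bound for the `2^w`-ary symmetric channel induced by STF: with
`x = 2^{−h}·(2^w − 1) ≤ 1/2`, the capacity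
`w + (2^w − 1)·2^{−h}·log₂(2^{−h}) + (1 − x)·log₂(1 − x)` is at least
`w − (h + 2)·2^{w−h}`. -/
theorem stf_capacity_lower_bound (h w : ℕ)
    (hx : (2 : ℝ) ^ (-(h : ℤ)) * ((2 : ℝ) ^ (w : ℕ) - 1) ≤ 1 / 2) :
    (w : ℝ) + ((2 : ℝ) ^ (w : ℕ) - 1) * (2 : ℝ) ^ (-(h : ℤ)) *
        Real.logb 2 ((2 : ℝ) ^ (-(h : ℤ)))
      + (1 - (2 : ℝ) ^ (-(h : ℤ)) * ((2 : ℝ) ^ (w : ℕ) - 1)) *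
        Real.logb 2 (1 - (2 : ℝ) ^ (-(h : ℤ)) * ((2 : ℝ) ^ (w : ℕ) - 1))
      ≥ (w : ℝ) - ((h : ℝ) + 2) * (2 : ℝ) ^ ((w : ℤ) - (h : ℤ)) := by
  have hpos : (0 : ℝ) < 2 ^ (-(h : ℤ)) := by positivity
  have hw : (1 : ℝ) ≤ 2 ^ w := one_le_pow₀ one_le_two
  have hlog : Real.logb 2 ((2 : ℝ) ^ (-(h : ℤ))) = -(h : ℝ) := by
    rw [← Real.rpow_intCast, Real.logb_rpow two_pos (by norm_num)]
    push_cast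
    rfl
  have hsplit : (2 : ℝ) ^ ((w : ℤ) - (h : ℤ)) = 2 ^ (-(h : ℤ)) * 2 ^ w := by
    rw [sub_eq_add_neg, zpow_add₀ two_ne_zero, zpow_natCast, mul_comm]
  rw [hlog, hsplit]
  generalize (2 : ℝ) ^ (-(h : ℤ)) = p at *
  have hx0 : 0 ≤ p * ((2 : ℝ) ^ w - 1) := mul_nonneg hpos.le (by linarith)
  have key := neg_two_mul_one_sub_le_mul_logb_two
    (y := 1 - p * ((2 : ℝ) ^ w - 1)) (by linarith) (by linarith)
  have hhp : 0 ≤ (h : ℝ) * p := by positivity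
  linarith
end

section
/- Let Σ be a finite type, let p : Σ → ℝ be nonnegative with ∑_{s} p(s) = 1, let R ≥ 1 be a natural number, let m ∈ Fin R be fixed, and let 0 < c < 1. For G : Σ → Fin R chosen uniformly at random (i.e., the values G(s) are independent and uniform on Fin R), the probability that ∑_{s : G(s) = m} p(s) ≤ c/R is at most exp(−2(1 − c)²/(R² · ∑_{s} p(s)²)). -/
open Finset

open MeasureTheory ProbabilityTheory in
/-- The uniform measure on all functions between finite types is the product of uniform measures. -/
lemma pi_uniformOn_univ_real_setOf {α β : Type*} [Fintype α] [Fintype β] [Nonempty β]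
    [MeasurableSpace β] [MeasurableSingletonClass β] (P : (α → β) → Prop) :
    (Measure.pi fun _ : α => uniformOn (Set.univ : Set β)).real {G | P G} =
      (Nat.card {G : α → β // P G} : ℝ) / (Nat.card (α → β) : ℝ) := by
  classical
  have h_singleton (G : α → β) :
      (Measure.pi fun _ : α => uniformOn (Set.univ : Set β)).real {G} =
        ((Nat.card (α → β) : ℝ))⁻¹ := by
    rw [measureReal_def, Measure.pi_singleton]
    simp [uniformOn_univ]
  have h_set : {G : α → β | P G} = ((univ.filter P : Finset (α → β)) : Set (α → β)) := by
    ext; simp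
  rw [h_set, ← sum_measureReal_singleton]
  simp only [h_singleton, sum_const, nsmul_eq_mul]
  rw [Nat.card_eq_fintype_card (α := {G : α → β // P G}), Fintype.card_subtype, div_eq_mul_inv]

open MeasureTheory ProbabilityTheory in
lemma integral_uniformOn_univ_ite_eq {β : Type*} [Fintype β] [DecidableEq β]
    [MeasurableSpace β] [MeasurableSingletonClass β] (m : β) (a : ℝ) :
    ∫ k, (if k = m then 0 else a) ∂(uniformOn (Set.univ : Set β)) =
      a * (1 - 1 / Fintype.card β) := by
  have : Nonempty β := ⟨m⟩
  have h_card : (Fintype.card β : ℝ) ≠ 0 := by simp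
  have h_singleton (k : β) :
      (uniformOn (Set.univ : Set β)).real {k} = (Fintype.card β : ℝ)⁻¹ := by
    simp [measureReal_def, uniformOn_univ]
  rw [integral_fintype (Integrable.of_finite)]
  simp only [h_singleton, smul_eq_mul, ← mul_sum]
  have h_sum : ∑ k, (if k = m then 0 else a) = (Fintype.card β - 1) * a := by
    have h_split (k : β) : (if k = m then 0 else a) = a - if k = m then a else 0 := by
      split_ifs <;> simp
    simp only [h_split, sum_sub_distrib, sum_ite_eq', mem_univ, if_true, sum_const, card_univ,
      nsmul_eq_mul]
    ring
  rw [h_sum]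
  field_simp

open MeasureTheory ProbabilityTheory in
/-- Hoeffding step of Theorem 4: for a uniformly random `G : α → Fin R`, the
probability that the mass `p` assigns to `G⁻¹(m)` is at most `c/R` is bounded
by `exp(−2(1 − c)²/(R²·∑ p(s)²))`. -/
theorem random_function_preimage_mass_bound {α : Type*} [Fintype α]
    (p : α → ℝ) (hp : ∀ s, 0 ≤ p s) (hsum : ∑ s, p s = 1)
    (R : ℕ) (hR : 1 ≤ R) (m : Fin R) (c : ℝ) (hc0 : 0 < c) (hc1 : c < 1) :
    (Nat.card {G : α → Fin R //
        ∑ s ∈ univ.filter (fun s => G s = m), p s ≤ c / R} : ℝ) /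
        (Nat.card (α → Fin R) : ℝ)
      ≤ Real.exp (-2 * (1 - c) ^ 2 / ((R : ℝ) ^ 2 * ∑ s, (p s) ^ 2)) := by
  have : Nonempty (Fin R) := ⟨m⟩
  let ν : Measure (Fin R) := uniformOn Set.univ
  let X : α → Fin R → ℝ := fun s k => if k = m then 0 else p s
  have h_subG (s : α) : HasSubgaussianMGF (fun G : α → Fin R => X s (G s) - ν[X s])
      ((‖p s - 0‖₊ / 2) ^ 2) (Measure.pi fun _ => ν) := by
    have h := hasSubgaussianMGF_of_mem_Icc (μ := ν) (X := X s) (a := 0) (b := p s)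
      (measurable_of_finite _).aemeasurable
      (ae_of_all _ fun k => by dsimp only [X]; split_ifs <;> simp [hp s])
    refine HasSubgaussianMGF.of_map (Y := fun G : α → Fin R => G s)
      (X := fun k => X s k - ν[X s]) (measurable_pi_apply s).aemeasurable ?_
    rwa [(measurePreserving_eval (fun _ : α => ν) s).map_eq]
  have h_indep : iIndepFun (fun s (G : α → Fin R) => X s (G s) - ν[X s])
      (Measure.pi fun _ => ν) :=
    iIndepFun_pi (X := fun s k => X s k - ν[X s]) fun s => (measurable_of_finite _).aemeasurable
  have hR0 : (0 : ℝ) < R := by exact_mod_cast hR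
  have h_hoeffding := HasSubgaussianMGF.measure_sum_ge_le_of_iIndepFun h_indep
    (s := univ) (fun s _ => h_subG s) (ε := (1 - c) / R) (div_nonneg (by linarith) hR0.le)
  have h_event (G : α → Fin R) : (1 - c) / R ≤ ∑ s, (X s (G s) - ν[X s]) ↔
      ∑ s ∈ univ.filter (fun s => G s = m), p s ≤ c / R := by
    have h_mean (s : α) : ν[X s] = p s * (1 - 1 / R) := by
      simpa using integral_uniformOn_univ_ite_eq m (p s)
    have h_val (s : α) : X s (G s) = p s - if G s = m then p s else 0 := by
      dsimp only [X]; split_ifs <;> simp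
    simp only [h_mean, h_val, sum_sub_distrib, ← sum_mul, hsum, sum_filter]
    rw [sub_div]
    constructor <;> intro h <;> linarith
  simp only [h_event] at h_hoeffding
  rw [pi_uniformOn_univ_real_setOf] at h_hoeffding
  refine h_hoeffding.trans_eq ?_
  congr 1
  push_cast
  simp only [sub_zero, div_pow, Real.norm_eq_abs, sq_abs, ← sum_div]
  have h_sq : ∑ s, p s ^ 2 ≠ 0 := by
    intro h
    have h_zero := (sum_eq_zero_iff_of_nonneg fun s _ => sq_nonneg (p s)).1 h
    have : ∑ s, p s = 0 := sum_eq_zero fun s hs => by simpa using h_zero s hs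
    linarith
  field_simp
end

section
/- Let Σ be a finite type, let h and w be natural numbers, and let p : Σ → ℝ be nonnegative with ∑_{s} p(s) = 1 and p(s) ≤ 2^{−h} for all s. For G : Σ → Fin 2^w chosen uniformly at random, the probability that there exists some m ∈ Fin 2^w with ∑_{s : G(s) = m} p(s) ≤ 2^{−w−1} is at most 2^w · exp(−2^{h−2w−1}). -/
open Finset

/-- **Hoeffding's lemma** for the uniform distribution on a finite type. -/
theorem sum_exp_mul_le_of_mem_Icc {β : Type*} [Fintype β] [Nonempty β] (f : β → ℝ)
    (hf : ∀ x, f x ∈ Set.Icc (0 : ℝ) 1) (t : ℝ) :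
    ∑ x, Real.exp (t * f x) ≤
      Fintype.card β * Real.exp (t * ((∑ x, f x) / Fintype.card β) + t ^ 2 / 8) := by
  let _ : MeasurableSpace β := ⊤
  have hN : (0 : ℝ) < Fintype.card β := by exact_mod_cast Fintype.card_pos
  have integral_uniform (g : β → ℝ) :
      ∫ x, g x ∂(PMF.uniformOfFintype β).toMeasure = (∑ x, g x) / Fintype.card β := by
    rw [PMF.integral_eq_sum]
    simp [← Finset.mul_sum, div_eq_inv_mul]
  have key := (ProbabilityTheory.hasSubgaussianMGF_of_mem_Icc
    (μ := (PMF.uniformOfFintype β).toMeasure) (X := f) (a := 0) (b := 1)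
    (Measurable.of_discrete.aemeasurable) (Filter.Eventually.of_forall hf)).mgf_le t
  simp only [ProbabilityTheory.mgf, integral_uniform] at key
  rw [div_le_iff₀ hN] at key
  simp only [mul_sub, Real.exp_sub, ← Finset.sum_div] at key
  rw [div_le_iff₀ (Real.exp_pos _)] at key
  refine key.trans_eq ?_
  rw [Real.exp_add]
  have : Real.exp (t ^ 2 / 8) =
      Real.exp (((‖(1 : ℝ) - 0‖₊ / 2) ^ 2 : NNReal) * t ^ 2 / 2) := by
    congr 1
    simp
    ring
  rw [this]
  ring

/-- Lower-tail bound, in counting form, for the mass a uniformly random function sends to a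
fixed point. -/
theorem card_filter_sum_fiber_le {α β : Type*} [Fintype α] [Fintype β] [DecidableEq α]
    [DecidableEq β] (p : α → ℝ) (m : β) (c t : ℝ) (ht : 0 ≤ t) :
    (#{G : α → β | ∑ s with G s = m, p s ≤ c} : ℝ) ≤
      (Fintype.card β : ℝ) ^ Fintype.card α *
        Real.exp (t * (c - (∑ s, p s) / Fintype.card β) + t ^ 2 * (∑ s, p s ^ 2) / 8) := by
  have : Nonempty β := ⟨m⟩
  have markov : (#{G : α → β | ∑ s with G s = m, p s ≤ c} : ℝ) ≤
      ∑ G : α → β, Real.exp (t * c) * ∏ s, Real.exp (-(t * p s) * if G s = m then 1 else 0) := by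
    rw [Finset.card_filter]
    push_cast
    refine Finset.sum_le_sum fun G _ => ?_
    rw [← Real.exp_sum, ← Real.exp_add]
    split_ifs with hG
    · refine Real.one_le_exp ?_
      have h := mul_le_mul_of_nonneg_left hG ht
      rw [Finset.sum_filter, Finset.mul_sum] at h
      simp only [mul_ite, mul_one, mul_zero] at h ⊢
      have : ∑ s, (if G s = m then -(t * p s) else 0) =
          -∑ s, (if G s = m then t * p s else 0) := by
        rw [← Finset.sum_neg_distrib]
        exact Finset.sum_congr rfl fun s _ => by split_ifs <;> simp
      linarith
    · positivity
  refine markov.trans ?_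
  rw [← Finset.mul_sum,
    ← Fintype.prod_sum (fun s x => Real.exp (-(t * p s) * if x = m then 1 else 0))]
  calc _ ≤ Real.exp (t * c) * ∏ s : α, ((Fintype.card β : ℝ) *
        Real.exp (-(t * p s) * (1 / Fintype.card β) + (-(t * p s)) ^ 2 / 8)) := by
        gcongr with s
        simpa using sum_exp_mul_le_of_mem_Icc (fun x : β => if x = m then (1 : ℝ) else 0)
          (fun x => by split_ifs <;> simp) (-(t * p s))
    _ = _ := by
        rw [Finset.prod_mul_distrib, ← Real.exp_sum, Finset.prod_const, Finset.card_univ,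
          mul_left_comm, ← Real.exp_add, Finset.sum_add_distrib, ← Finset.sum_mul,
          Finset.sum_neg_distrib, ← Finset.mul_sum, ← Finset.sum_div]
        simp only [neg_sq, mul_pow, ← Finset.mul_sum]
        congr 2
        ring

/-- Skewed-function bound of Theorem 4: for a channel distribution `p` of
min-entropy `h` and a uniformly random `G : α → Fin 2^w`, the probability that
some message `m` receives mass at most `2^{−w−1}` under `p ∘ G⁻¹` is at most
`2^w·exp(−2^{h−2w−1})`. -/
theorem random_function_skewed_bound {α : Type*} [Fintype α] (h w : ℕ)
    (p : α → ℝ) (hp : ∀ s, 0 ≤ p s) (hsum : ∑ s, p s = 1)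
    (hmax : ∀ s, p s ≤ (2 : ℝ) ^ (-(h : ℤ))) :
    (Nat.card {G : α → Fin (2 ^ w) // ∃ m : Fin (2 ^ w),
        ∑ s ∈ univ.filter (fun s => G s = m), p s ≤ (2 : ℝ) ^ (-(w : ℤ) - 1)} : ℝ) /
        (Nat.card (α → Fin (2 ^ w)) : ℝ)
      ≤ (2 : ℝ) ^ (w : ℕ) * Real.exp (-(2 : ℝ) ^ ((h : ℤ) - 2 * w - 1)) := by
  classical
  have sum_sq_le : ∑ s, p s ^ 2 ≤ (2 : ℝ) ^ (-(h : ℤ)) :=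
    calc ∑ s, p s ^ 2 ≤ ∑ s, (2 : ℝ) ^ (-(h : ℤ)) * p s := by
          refine Finset.sum_le_sum fun s _ => ?_
          rw [sq]
          exact mul_le_mul_of_nonneg_right (hmax s) (hp s)
      _ = (2 : ℝ) ^ (-(h : ℤ)) := by rw [← Finset.mul_sum, hsum, mul_one]
  have tail (m : Fin (2 ^ w)) :
      (#{G : α → Fin (2 ^ w) | ∑ s with G s = m, p s ≤ (2 : ℝ) ^ (-(w : ℤ) - 1)} : ℝ) ≤
        ((2 : ℝ) ^ w) ^ Fintype.card α * Real.exp (-(2 : ℝ) ^ ((h : ℤ) - 2 * w - 1)) := by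
    have bound := card_filter_sum_fiber_le p m ((2 : ℝ) ^ (-(w : ℤ) - 1))
      (2 * 2 ^ h / 2 ^ w) (by positivity)
    rw [hsum, Fintype.card_fin] at bound
    push_cast at bound
    refine bound.trans ?_
    gcongr
    calc _ ≤ 2 * 2 ^ h / 2 ^ w * ((2 : ℝ) ^ (-(w : ℤ) - 1) - 1 / 2 ^ w) +
          (2 * 2 ^ h / 2 ^ w) ^ 2 * (2 : ℝ) ^ (-(h : ℤ)) / 8 := by gcongr
      _ = _ := by
          have two_mul_w : (2 : ℝ) ^ (2 * (w : ℤ)) = 2 ^ w * 2 ^ w := by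
            rw [two_mul, zpow_add₀ two_ne_zero, zpow_natCast]
          rw [zpow_sub₀ two_ne_zero, zpow_sub₀ two_ne_zero, zpow_sub₀ two_ne_zero, two_mul_w]
          simp only [zpow_neg, zpow_natCast, zpow_one]
          field_simp
          ring
  rw [Nat.card_eq_fintype_card, Nat.card_eq_fintype_card, Fintype.card_fun, Fintype.card_fin,
    Fintype.card_subtype]
  push_cast
  rw [div_le_iff₀ (by positivity)]
  calc _ ≤ (∑ m : Fin (2 ^ w),
        #{G : α → Fin (2 ^ w) | ∑ s with G s = m, p s ≤ (2 : ℝ) ^ (-(w : ℤ) - 1)} : ℝ) := by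
        norm_cast
        refine le_trans (Finset.card_le_card fun G hG => ?_) Finset.card_biUnion_le
        simpa using hG
    _ ≤ ∑ _m : Fin (2 ^ w),
        ((2 : ℝ) ^ w) ^ Fintype.card α * Real.exp (-(2 : ℝ) ^ ((h : ℤ) - 2 * w - 1)) :=
        Finset.sum_le_sum fun m _ => tail m
    _ = _ := by
        rw [Finset.sum_const, Finset.card_univ, Fintype.card_fin, nsmul_eq_mul]
        push_cast
        ring
end
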